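/- The symmetrization map φ_W : k[V][h] → A_h(V), sending a monomial u₁⋯u_m (uᵢ ∈ V*) to the average (1/m!)∑_{σ∈S_m} u_{σ(1)}⋯u_{σ(m)} in the Weyl algebra, is a bijection of k[h]-modules (PBW theorem for the Weyl algebra). -/

import Mathlib

open MvPolynomial

/-- The relations of the Weyl algebra `A_h(V)`:
`u ⊗ u' − u' ⊗ u = h·⟨π, u ⊗ u'⟩` for `u, u'` in a basis of `V*`. -/
inductive weylRel {k : Type*} [Field k] {ι : Type*} (π : ι → ι → k) :
    FreeAlgebra (Polynomial k) ι → FreeAlgebra (Polynomial k) ι → Prop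
  | comm (i j : ι) : weylRel π
      (FreeAlgebra.ι (Polynomial k) i * FreeAlgebra.ι (Polynomial k) j
        - FreeAlgebra.ι (Polynomial k) j * FreeAlgebra.ι (Polynomial k) i)
      (algebraMap (Polynomial k) _ (Polynomial.X * Polynomial.C (π i j)))

/-- The Weyl algebra `A_h(V) = (TV*)[h]/I(u⊗u' − u'⊗u − h⟨π, u⊗u'⟩)`. -/
abbrev Weyl {k : Type*} [Field k] {ι : Type*} (π : ι → ι → k) :=
  RingQuot (weylRel π)

variable {k : Type*} [Field k] [CharZero k]
variable {ι : Type*} [Fintype ι] [DecidableEq ι]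

/-- The symmetrization of a single monomial: the average over all orderings of its
variables of the corresponding product in the Weyl algebra. -/
noncomputable def symMon (π : ι → ι → k) (m : ι →₀ ℕ) : Weyl π :=
  algebraMap (Polynomial k) (Weyl π)
      (Polynomial.C (((Finsupp.toMultiset m).toList.length.factorial : k)⁻¹)) *
    ∑ s : Equiv.Perm (Fin (Finsupp.toMultiset m).toList.length),
      (List.ofFn fun t =>
        RingQuot.mkAlgHom (Polynomial k) (weylRel π)
          (FreeAlgebra.ι (Polynomial k) ((Finsupp.toMultiset m).toList.get (s t)))).prod

/-- The symmetrization map `φ_W : k[V][h] → A_h(V)`. -/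
noncomputable def phiW (π : ι → ι → k)
    (f : MvPolynomial ι (Polynomial k)) : Weyl π :=
  ∑ m ∈ f.support, MvPolynomial.coeff m f • symMon π m

namespace Weyl

/-- The image in the Weyl algebra of a generator. -/
noncomputable def gen {k ι : Type*} [Field k] (π : ι → ι → k) (i : ι) : Weyl π :=
  RingQuot.mkAlgHom (Polynomial k) (weylRel π) (FreeAlgebra.ι (Polynomial k) i)

/-- The product in the Weyl algebra of a list of generators. -/
noncomputable def word {k ι : Type*} [Field k] (π : ι → ι → k) (l : List ι) : Weyl π :=
  (l.map (gen π)).prod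

/-- The span of the words of length less than `d`. -/
noncomputable def wordsLT {k ι : Type*} [Field k] (π : ι → ι → k) (d : ℕ) :
    Submodule (Polynomial k) (Weyl π) :=
  Submodule.span _ (word π '' {l | l.length < d})

/-- The polynomials all of whose monomials have degree less than `d`. -/
noncomputable def degLT (R ι : Type*) [CommSemiring R] (d : ℕ) :
    Submodule R (MvPolynomial ι R) :=
  restrictSupport R {m | m.degree < d}

section Words

variable {k ι : Type*} [Field k] (π : ι → ι → k)

theorem gen_mul_gen_sub (i j : ι) :
    gen π i * gen π j - gen π j * gen π i =
      algebraMap (Polynomial k) (Weyl π) (Polynomial.X * Polynomial.C (π i j)) := by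
  have h := RingQuot.mkAlgHom_rel (Polynomial k) (weylRel.comm (π := π) i j)
  simpa only [map_sub, map_mul, AlgHom.commutes, gen] using h

@[simp]
theorem word_cons (i : ι) (l : List ι) : word π (i :: l) = gen π i * word π l := by
  simp [word]

theorem word_mem_wordsLT {l : List ι} {d : ℕ} (h : l.length < d) : word π l ∈ wordsLT π d :=
  Submodule.subset_span ⟨l, h, rfl⟩

theorem gen_mul_mem_wordsLT (i : ι) {d : ℕ} {a : Weyl π} (ha : a ∈ wordsLT π d) :
    gen π i * a ∈ wordsLT π (d + 1) := by
  induction ha using Submodule.span_induction with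
  | mem x hx =>
    obtain ⟨l, hl, rfl⟩ := hx
    rw [← word_cons]
    exact word_mem_wordsLT π (by simpa using hl)
  | zero => simp
  | add x y _ _ hx hy => rw [mul_add]; exact add_mem hx hy
  | smul c x _ hx => rw [mul_smul_comm]; exact Submodule.smul_mem _ _ hx

theorem word_sub_mem_of_perm {l l' : List ι} (h : l.Perm l') :
    word π l - word π l' ∈ wordsLT π l.length := by
  induction h with
  | nil => exact (sub_self (word π [])).symm ▸ zero_mem _
  | cons x _ ih =>
    rw [word_cons, word_cons]
    exact mul_sub (gen π x) _ _ ▸ gen_mul_mem_wordsLT π x ih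
  | swap x y l =>
    have h : word π (y :: x :: l) - word π (x :: y :: l) =
        (Polynomial.X * Polynomial.C (π y x)) • word π l := by
      rw [Algebra.smul_def, ← gen_mul_gen_sub]
      simp only [word_cons, ← mul_assoc]
      exact (sub_mul (gen π y * gen π x) (gen π x * gen π y) (word π l)).symm
    rw [h]
    exact Submodule.smul_mem _ _ (word_mem_wordsLT π (by simp))
  | trans h _ ih ih' =>
    rw [← h.length_eq] at ih'
    exact sub_add_sub_cancel (word π _) _ _ ▸ add_mem ih ih'

theorem exists_mem_wordsLT (a : Weyl π) : ∃ d, a ∈ wordsLT π d := by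
  obtain ⟨x, rfl⟩ := RingQuot.mkAlgHom_surjective (Polynomial k) (weylRel π) a
  have mono : Monotone (wordsLT π) := fun d e h =>
    Submodule.span_mono (Set.image_mono fun l (hl : _ < d) => hl.trans_le h)
  suffices h : ∀ d, ∀ a ∈ wordsLT π d,
      ∃ e, RingQuot.mkAlgHom (Polynomial k) (weylRel π) x * a ∈ wordsLT π e by
    simpa using h 1 1 (word_mem_wordsLT π (l := []) Nat.one_pos)
  induction x using FreeAlgebra.induction with
  | grade0 r =>
    intro d a ha
    refine ⟨d, ?_⟩
    rw [AlgHom.commutes, ← Algebra.smul_def]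
    exact Submodule.smul_mem _ _ ha
  | grade1 i => exact fun d a ha => ⟨d + 1, gen_mul_mem_wordsLT π i ha⟩
  | mul x y hx hy =>
    intro d a ha
    obtain ⟨e, he⟩ := hy d a ha
    obtain ⟨e', he'⟩ := hx e _ he
    exact ⟨e', by rwa [map_mul, mul_assoc]⟩
  | add x y hx hy =>
    intro d a ha
    obtain ⟨e, he⟩ := hx d a ha
    obtain ⟨e', he'⟩ := hy d a ha
    refine ⟨max e e', ?_⟩
    rw [map_add, add_mul]
    exact add_mem (mono (le_max_left _ _) he) (mono (le_max_right _ _) he')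

end Words

section Moyal

variable {k ι : Type*} [Field k] (π : ι → ι → k)

/-- The Hamiltonian derivation `x_j ↦ (h / 2) π i j`. -/
noncomputable def halfBracket (i : ι) :
    Derivation (Polynomial k) (MvPolynomial ι (Polynomial k)) (MvPolynomial ι (Polynomial k)) :=
  mkDerivation _ fun j => C (Polynomial.X * Polynomial.C (π i j / 2))

/-- Left Moyal multiplication by `x_i`, i.e. `p ↦ x_i p + (h / 2) {x_i, p}`. -/
noncomputable def moyal (i : ι) : Module.End (Polynomial k) (MvPolynomial ι (Polynomial k)) :=
  LinearMap.mulLeft _ (X i) + (halfBracket π i).toLinearMap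

theorem moyal_apply (i : ι) (p : MvPolynomial ι (Polynomial k)) :
    moyal π i p = X i * p + halfBracket π i p := rfl

theorem halfBracket_X (i j : ι) :
    halfBracket π i (X j) = C (Polynomial.X * Polynomial.C (π i j / 2)) :=
  mkDerivation_X _ _ _

theorem halfBracket_comm (i j : ι) (p : MvPolynomial ι (Polynomial k)) :
    halfBracket π i (halfBracket π j p) = halfBracket π j (halfBracket π i p) := by
  have h : ⁅halfBracket π i, halfBracket π j⁆ = 0 := derivation_ext fun l => by
    simp [Derivation.commutator_apply, halfBracket_X, -map_mul]
  have := congrArg (fun D => D p) h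
  simpa [Derivation.commutator_apply, sub_eq_zero] using this

theorem moyal_commutator [CharZero k] (hπ : ∀ i j, π j i = -π i j) (i j : ι) :
    moyal π i * moyal π j - moyal π j * moyal π i =
      algebraMap (Polynomial k) _ (Polynomial.X * Polynomial.C (π i j)) := by
  refine LinearMap.ext fun p => ?_
  have hC : C (Polynomial.X * Polynomial.C (π i j)) =
      (C (Polynomial.X * Polynomial.C (π i j / 2)) -
        C (Polynomial.X * Polynomial.C (π j i / 2)) : MvPolynomial ι (Polynomial k)) := by
    rw [← C_sub, ← mul_sub, ← Polynomial.C_sub, hπ i j]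
    congr 3
    ring
  simp only [LinearMap.sub_apply, Module.End.mul_apply, Module.algebraMap_end_apply,
    moyal_apply, map_add, Derivation.leibniz, halfBracket_X, smul_eq_C_mul, smul_eq_mul]
  rw [halfBracket_comm π i j, hC]
  ring

/-- The Moyal representation of the Weyl algebra on polynomials. -/
noncomputable def moyalRep [CharZero k] (hπ : ∀ i j, π j i = -π i j) :
    Weyl π →ₐ[Polynomial k] Module.End (Polynomial k) (MvPolynomial ι (Polynomial k)) :=
  RingQuot.liftAlgHom _ ⟨FreeAlgebra.lift _ (moyal π), by
    rintro _ _ ⟨i, j⟩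
    simp only [map_sub, map_mul, FreeAlgebra.lift_ι_apply]
    rw [moyal_commutator π hπ]
    rw [← map_mul, ← map_mul, AlgHom.commutes]⟩

/-- The symbol of an element of the Weyl algebra: its Moyal action on `1`. -/
noncomputable def symbol [CharZero k] (hπ : ∀ i j, π j i = -π i j) :
    Weyl π →ₗ[Polynomial k] MvPolynomial ι (Polynomial k) :=
  LinearMap.applyₗ 1 ∘ₗ (moyalRep π hπ).toLinearMap

theorem symbol_gen_mul [CharZero k] (hπ : ∀ i j, π j i = -π i j) (i : ι) (a : Weyl π) :
    symbol π hπ (gen π i * a) = moyal π i (symbol π hπ a) := by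
  simp [symbol, moyalRep, gen]

theorem symbol_one [CharZero k] (hπ : ∀ i j, π j i = -π i j) : symbol π hπ 1 = 1 := by
  simp [symbol]

theorem monomial_mem_degLT {R : Type*} [CommSemiring R] {m : ι →₀ ℕ} {d : ℕ}
    (h : m.degree < d) (r : R) : monomial m r ∈ degLT R ι d := by
  classical
  exact fun x hx => by
    obtain rfl := Finset.mem_singleton.1 (support_monomial_subset hx)
    exact h

theorem degLT_induction {R M : Type*} [CommSemiring R] [AddCommMonoid M] [Module R M] {d : ℕ}
    (f : MvPolynomial ι R →ₗ[R] M) (N : Submodule R M)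
    (h : ∀ m : ι →₀ ℕ, m.degree < d → f (monomial m 1) ∈ N)
    {p : MvPolynomial ι R} (hp : p ∈ degLT R ι d) : f p ∈ N := by
  have : degLT R ι d ≤ N.comap f := by
    rw [degLT, restrictSupport_eq_span, Submodule.span_le]
    rintro _ ⟨m, hm, rfl⟩
    exact h m hm
  exact this hp

theorem X_mul_mem_degLT {R : Type*} [CommSemiring R] (i : ι) {d : ℕ} {p : MvPolynomial ι R}
    (hp : p ∈ degLT R ι d) : X i * p ∈ degLT R ι (d + 1) := by
  refine degLT_induction (LinearMap.mulLeft R (X i)) _ (fun m hm => ?_) hp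
  rw [LinearMap.mulLeft_apply, X, monomial_mul]
  refine monomial_mem_degLT ?_ _
  rw [map_add, Finsupp.degree_single]
  lia

theorem halfBracket_mem_degLT (i : ι) {d : ℕ} {p : MvPolynomial ι (Polynomial k)}
    (hp : p ∈ degLT _ ι d) : halfBracket π i p ∈ degLT _ ι d := by
  refine degLT_induction (halfBracket π i).toLinearMap _ (fun m hm => ?_) hp
  rw [Derivation.coeFn_coe, halfBracket, mkDerivation_monomial, one_smul]
  refine Submodule.sum_mem _ fun j _ => ?_
  dsimp only
  rw [smul_eq_mul, mul_comm, C_mul_monomial]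
  refine monomial_mem_degLT (lt_of_le_of_lt ?_ hm) _
  exact Finsupp.degree_mono tsub_le_self

theorem moyal_mem_degLT (i : ι) {d : ℕ} {p : MvPolynomial ι (Polynomial k)}
    (hp : p ∈ degLT _ ι d) : moyal π i p ∈ degLT _ ι (d + 1) := by
  refine add_mem (X_mul_mem_degLT i hp) ?_
  exact restrictSupport_mono _ (fun m (hm : _ < d) => hm.trans d.lt_succ_self)
    (halfBracket_mem_degLT π i hp)

theorem prod_map_X {R : Type*} [CommSemiring R] [DecidableEq ι] (l : List ι) :
    (l.map (X : ι → MvPolynomial ι R)).prod = monomial (Multiset.toFinsupp (l : Multiset ι)) 1 := by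
  induction l with
  | nil => simp
  | cons i l ih =>
    rw [List.map_cons, List.prod_cons, ih, X, monomial_mul, ← Multiset.cons_coe,
      ← Multiset.singleton_add, map_add, Multiset.toFinsupp_singleton, one_mul]

theorem degree_toFinsupp_coe [DecidableEq ι] (l : List ι) :
    (Multiset.toFinsupp (l : Multiset ι)).degree = l.length := by
  induction l with
  | nil => simp
  | cons i l ih =>
    rw [← Multiset.cons_coe, ← Multiset.singleton_add, map_add, map_add,
      Multiset.toFinsupp_singleton, Finsupp.degree_single, ih, List.length_cons, add_comm]

theorem symbol_word_sub_mem [CharZero k] (hπ : ∀ i j, π j i = -π i j) (l : List ι) :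
    symbol π hπ (word π l) - (l.map X).prod ∈ degLT _ ι l.length := by
  classical
  induction l with
  | nil => simp [word, symbol_one]
  | cons i l ih =>
    have hl : (l.map X).prod ∈ degLT (Polynomial k) ι (l.length + 1) := by
      rw [prod_map_X]
      exact monomial_mem_degLT (by rw [degree_toFinsupp_coe]; lia) _
    rw [word_cons, symbol_gen_mul, List.map_cons, List.prod_cons, List.length_cons]
    have h : moyal π i (symbol π hπ (word π l)) - X i * (l.map X).prod =
        moyal π i (symbol π hπ (word π l) - (l.map X).prod) +
          halfBracket π i (l.map X).prod := by
      rw [map_sub, moyal_apply π i (l.map X).prod]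
      ring
    rw [h]
    exact add_mem (moyal_mem_degLT π i ih) (halfBracket_mem_degLT π i hl)

theorem symbol_mem_degLT [CharZero k] (hπ : ∀ i j, π j i = -π i j) {d : ℕ} {a : Weyl π}
    (ha : a ∈ wordsLT π d) : symbol π hπ a ∈ degLT _ ι d := by
  classical
  suffices h : wordsLT π d ≤ (degLT _ ι d).comap (symbol π hπ) from h ha
  rw [wordsLT, Submodule.span_le]
  rintro _ ⟨l, hl : l.length < d, rfl⟩
  have hX : (l.map X).prod ∈ degLT (Polynomial k) ι d := by
    rw [prod_map_X]
    exact monomial_mem_degLT (by rwa [degree_toFinsupp_coe]) _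
  have hsub : _ ∈ degLT _ ι d := restrictSupport_mono _ (fun m (hm : _ < l.length) => hm.trans hl)
    (symbol_word_sub_mem π hπ l)
  simpa using add_mem hsub hX

end Moyal

section Symmetrization

variable {k ι : Type*} [Field k] (π : ι → ι → k)

theorem phiW_eq_constr :
    phiW π = (basisMonomials ι (Polynomial k)).constr (Polynomial k) (symMon π) := by
  funext f
  rw [Module.Basis.constr_apply]
  rfl

variable [CharZero k]

theorem symMon_sub_word_mem (m : ι →₀ ℕ) :
    symMon π m - word π (Finsupp.toMultiset m).toList ∈
      wordsLT π (Finsupp.toMultiset m).toList.length := by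
  rw [symMon]
  set l := (Finsupp.toMultiset m).toList
  have hterm (s : Equiv.Perm (Fin l.length)) :
      (List.ofFn fun t => RingQuot.mkAlgHom (Polynomial k) (weylRel π)
        (FreeAlgebra.ι (Polynomial k) (l.get (s t)))).prod =
      word π (List.ofFn (l.get ∘ s)) := by
    rw [word, List.map_ofFn]
    rfl
  have havg : word π l = algebraMap (Polynomial k) (Weyl π)
      (Polynomial.C ((l.length.factorial : k)⁻¹)) *
        ∑ _s : Equiv.Perm (Fin l.length), word π l := by
    have hne : (l.length.factorial : k) ≠ 0 := Nat.cast_ne_zero.2 (Nat.factorial_ne_zero _)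
    rw [Finset.sum_const, Finset.card_univ, Fintype.card_perm, Fintype.card_fin, ← Algebra.smul_def,
      ← Nat.cast_smul_eq_nsmul (Polynomial k), smul_smul, ← Polynomial.C_eq_natCast,
      ← Polynomial.C_mul, inv_mul_cancel₀ hne, Polynomial.C_1, one_smul]
  have hsub : algebraMap (Polynomial k) (Weyl π) (Polynomial.C ((l.length.factorial : k)⁻¹)) *
        ∑ s : Equiv.Perm (Fin l.length), word π (List.ofFn (l.get ∘ s)) - word π l =
      (Polynomial.C ((l.length.factorial : k)⁻¹)) •
        ∑ s : Equiv.Perm (Fin l.length), (word π (List.ofFn (l.get ∘ s)) - word π l) := by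
    conv_lhs => rw [havg]
    have hsum : ∑ s : Equiv.Perm (Fin l.length), (word π (List.ofFn (l.get ∘ s)) - word π l) =
        ∑ s : Equiv.Perm (Fin l.length), word π (List.ofFn (l.get ∘ s)) -
          ∑ _s : Equiv.Perm (Fin l.length), word π l :=
      Finset.sum_sub_distrib (G := Weyl π) _ _
    rw [Algebra.smul_def, hsum]
    exact (mul_sub (algebraMap (Polynomial k) (Weyl π) _) _ _).symm
  simp only [hterm]
  rw [hsub]
  refine Submodule.smul_mem _ _ (Submodule.sum_mem _ fun s _ => ?_)
  have hperm : (List.ofFn (l.get ∘ s)).Perm l := by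
    simpa only [List.ofFn_get] using Equiv.Perm.ofFn_comp_perm s l.get
  simpa only [hperm.length_eq] using word_sub_mem_of_perm π hperm

theorem toFinsupp_toList [DecidableEq ι] (m : ι →₀ ℕ) :
    Multiset.toFinsupp ((Finsupp.toMultiset m).toList : Multiset ι) = m := by
  rw [Multiset.coe_toList, Finsupp.toMultiset_toFinsupp]

theorem symbol_symMon_sub_mem (hπ : ∀ i j, π j i = -π i j) (m : ι →₀ ℕ) :
    symbol π hπ (symMon π m) - monomial m 1 ∈ degLT _ ι m.degree := by
  classical
  have h₁ := symbol_mem_degLT π hπ (symMon_sub_word_mem π m)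
  have h₂ := symbol_word_sub_mem π hπ (Finsupp.toMultiset m).toList
  rw [← degree_toFinsupp_coe, toFinsupp_toList] at h₁ h₂
  rw [prod_map_X, toFinsupp_toList] at h₂
  have h := add_mem h₁ h₂
  have hsub := map_sub (symbol π hπ) (symMon π m) (word π (Finsupp.toMultiset m).toList)
  exact sub_add_sub_cancel (symbol π hπ (symMon π m)) _ _ ▸ hsub ▸ h

theorem wordsLT_le_range (d : ℕ) : wordsLT π d ≤
    LinearMap.range ((basisMonomials ι (Polynomial k)).constr (Polynomial k) (symMon π)) := by
  classical
  induction d with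
  | zero => simp [wordsLT]
  | succ d ih =>
    rw [wordsLT, Submodule.span_le]
    rintro _ ⟨l, hl : l.length < d + 1, rfl⟩
    set m := Multiset.toFinsupp (l : Multiset ι) with hm
    have hperm : (Finsupp.toMultiset m).toList.Perm l := by
      rw [← Multiset.coe_eq_coe, Multiset.coe_toList, hm, Multiset.toFinsupp_toMultiset]
    have h := add_mem (symMon_sub_word_mem π m) (word_sub_mem_of_perm π hperm)
    replace h := sub_add_sub_cancel (symMon π m) _ _ ▸ h
    rw [hperm.length_eq] at h
    have hle : wordsLT π l.length ≤ wordsLT π d :=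
      Submodule.span_mono (Set.image_mono fun l' (hl' : _ < l.length) =>
        hl'.trans_le (Nat.lt_succ_iff.1 hl))
    obtain ⟨p, hp⟩ := ih (hle h)
    refine ⟨basisMonomials ι (Polynomial k) m - p, (map_sub _ _ _).trans ?_⟩
    rw [hp, Module.Basis.constr_basis]
    exact sub_sub_cancel (symMon π m) (word π l)

theorem symbol_phiW_sub_mem (hπ : ∀ i j, π j i = -π i j) {d : ℕ}
    {f : MvPolynomial ι (Polynomial k)} (hf : f ∈ degLT _ ι (d + 1)) :
    symbol π hπ (phiW π f) - f ∈ degLT _ ι d := by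
  rw [phiW_eq_constr]
  refine degLT_induction (symbol π hπ ∘ₗ
    (basisMonomials ι (Polynomial k)).constr (Polynomial k) (symMon π) - LinearMap.id) _
    (fun m hm => ?_) hf
  have h := Module.Basis.constr_basis (basisMonomials ι (Polynomial k)) (Polynomial k) (symMon π) m
  rw [coe_basisMonomials] at h
  rw [LinearMap.sub_apply, LinearMap.comp_apply, h, LinearMap.id_apply]
  exact restrictSupport_mono _ (fun m' (hm' : _ < m.degree) => hm'.trans_le (Nat.lt_succ_iff.1 hm))
    (symbol_symMon_sub_mem π hπ m)

theorem eq_zero_of_phiW_eq_zero (hπ : ∀ i j, π j i = -π i j) {f : MvPolynomial ι (Polynomial k)}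
    (hf : phiW π f = 0) : f = 0 := by
  have hstep (d : ℕ) (h : f ∈ degLT _ ι d) : f = 0 := by
    induction d with
    | zero =>
      rw [← support_eq_empty, Finset.eq_empty_iff_forall_notMem]
      exact fun m hm => Nat.not_lt_zero _ (h hm)
    | succ d ih => exact ih (by simpa [hf] using symbol_phiW_sub_mem π hπ h)
  exact hstep (f.support.sup Finsupp.degree + 1) fun m hm =>
    Nat.lt_succ_of_le (Finset.le_sup (f := Finsupp.degree) hm)

end Symmetrization

end Weyl

/-- PBW for the Weyl algebra: the symmetrization map
`φ_W : k[V][h] → A_h(V)` is a `k[h]`-linear bijection. -/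
theorem phiW_bijective (π : ι → ι → k) (hπ : ∀ i j, π j i = -π i j)
    (hnd : (Matrix.of π).det ≠ 0) :
    Function.Bijective (phiW π) ∧
    (∀ f g : MvPolynomial ι (Polynomial k), phiW π (f + g) = phiW π f + phiW π g) ∧
    (∀ (c : Polynomial k) (f : MvPolynomial ι (Polynomial k)),
      phiW π (c • f) = c • phiW π f) := by
  rw [Weyl.phiW_eq_constr]
  refine ⟨⟨?_, fun a => ?_⟩, map_add _, map_smul _⟩
  · rw [injective_iff_map_eq_zero]
    intro f hf
    rw [← Weyl.phiW_eq_constr] at hf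
    exact Weyl.eq_zero_of_phiW_eq_zero π hπ hf
  · obtain ⟨d, hd⟩ := Weyl.exists_mem_wordsLT π a
    exact Weyl.wordsLT_le_range π d hd
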